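/- For every real number γ > 0, the series ∑_{j=1}^∞ 2(j-1/2)²π² / ((j-1/2)²π² + 2γ)² converges and equals tanh(√(2γ))/(2√(2γ)) + (1/2)·sech(√(2γ))². -/

import Mathlib

open Real

lemma coth_aux (s : ℝ) (hs : s ≠ 0) :
    HasSum (fun n : ℕ => 2 * s / (((n : ℝ) + 1)^2 * π^2 + s^2))
      (Real.cosh s / Real.sinh s - 1 / s) := by
  have hpi : (π : ℂ) ≠ 0 := by exact_mod_cast Real.pi_ne_zero
  have hsC : (s : ℂ) ≠ 0 := by exact_mod_cast hs
  have hsh : Complex.sinh (s : ℂ) ≠ 0 := by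
    rw [← Complex.ofReal_sinh]
    exact_mod_cast (Real.sinh_ne_zero.mpr hs)
  have hx : ((s : ℂ) * Complex.I / π) ∈ Complex.integerComplement := by
    rintro ⟨n, hn⟩
    have := congrArg Complex.im hn
    have h2 : ((s : ℂ) * Complex.I / π).im = s / π := by
      rw [Complex.div_ofReal_im]; simp
    rw [h2] at this
    rw [Complex.intCast_im] at this
    exact div_ne_zero hs Real.pi_ne_zero this.symm
  have h1 := (summable_cotTerm hx).hasSum
  have h2 := cot_series_rep' hx
  change _ = ∑' n : ℕ, cotTerm ((s : ℂ) * Complex.I / π) n at h2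
  rw [← h2] at h1
  have h3 := h1.mul_left (Complex.I / π)
  rw [← Complex.hasSum_ofReal]
  convert! h3 using 1
  · funext n
    rw [cotTerm_identity hx]
    have hd : ((((n : ℝ) + 1)^2 * π^2 + s^2 : ℝ) : ℂ) ≠ 0 := by
      have : 0 < (((n : ℝ) + 1)^2 * π^2 + s^2 : ℝ) := by positivity
      exact_mod_cast this.ne'
    have e : ((s : ℂ) * Complex.I / π + (n + 1)) * ((s : ℂ) * Complex.I / π - (n + 1))
        = - ((((n : ℝ) + 1)^2 * π^2 + s^2 : ℝ) : ℂ) / π^2 := by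
      push_cast
      field_simp
      ring_nf
      rw [Complex.I_sq]; ring
    rw [e, Complex.ofReal_div]
    field_simp
    rw [Complex.I_sq]; push_cast; ring
  · have e : (π : ℂ) * ((s : ℂ) * Complex.I / π) = s * Complex.I := by field_simp
    rw [e, Complex.cot, Complex.cos_mul_I, Complex.sin_mul_I]
    push_cast
    have := Complex.I_ne_zero
    field_simp

lemma tanh_aux (s : ℝ) (hs : s ≠ 0) :
    HasSum (fun n : ℕ => 2 * s / (((n : ℝ) + 1 - 1/2)^2 * π^2 + s^2)) (Real.tanh s) := by
  have hsum : Summable (fun n : ℕ => 2 * s / (((n : ℝ) + 1 - 1/2)^2 * π^2 + s^2)) := by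
    have := ((coth_aux (2*s) (by positivity)).summable.comp_injective
      (i := fun k : ℕ => 2 * k) (fun a b h => by simpa using h)).mul_left 2
    convert! this using 1
    funext n
    simp only [Function.comp]
    push_cast
    rw [← mul_div_assoc, div_eq_div_iff (by positivity) (by positivity)]
    ring
  have hA := coth_aux s hs
  have hB := (coth_aux (2*s) (by positivity)).mul_left 2
  have hC := HasSum.even_add_odd (f := fun n : ℕ => 2 * (2 * (2*s) / (((n : ℝ) + 1)^2 * π^2 + (2*s)^2)))
    (m := ∑' n : ℕ, 2 * s / (((n : ℝ) + 1 - 1/2)^2 * π^2 + s^2))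
    (m' := Real.cosh s / Real.sinh s - 1 / s)
    (by
      convert! hsum.hasSum using 1
      funext n
      push_cast
      rw [← mul_div_assoc, div_eq_div_iff (by positivity) (by positivity)]
      ring)
    (by
      convert! hA using 1
      funext n
      push_cast
      rw [← mul_div_assoc, div_eq_div_iff (by positivity) (by positivity)]
      ring)
  have hD := hC.unique hB
  have hsh : Real.sinh s ≠ 0 := Real.sinh_ne_zero.mpr hs
  have hch : Real.cosh s ≠ 0 := (Real.cosh_pos s).ne'
  have : Real.tanh s = ∑' n : ℕ, 2 * s / (((n : ℝ) + 1 - 1/2)^2 * π^2 + s^2) := by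
    rw [eq_sub_of_add_eq hD, Real.tanh_eq_sinh_div_cosh, Real.sinh_two_mul, Real.cosh_two_mul]
    field_simp
    ring
  rw [this]
  exact hsum.hasSum

lemma sech_aux (s : ℝ) (hs : 0 < s) :
    HasSum (fun n : ℕ => 2 * (((n : ℝ) + 1 - 1/2)^2 * π^2 - s^2) /
      (((n : ℝ) + 1 - 1/2)^2 * π^2 + s^2)^2) ((1 / Real.cosh s)^2) := by
  have ha : ∀ n : ℕ, 0 < ((n : ℝ) + 1 - 1/2)^2 * π^2 := fun n => by
    have : (0:ℝ) < (n : ℝ) + 1 - 1/2 := by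
      have : (0:ℝ) ≤ n := n.cast_nonneg
      linarith
    positivity
  have hu : Summable (fun n : ℕ => 2 / (((n : ℝ) + 1 - 1/2)^2 * π^2)) := by
    have h := (tanh_aux 1 one_ne_zero).summable.mul_left (1 + 4 / π^2)
    refine Summable.of_nonneg_of_le (fun n => (div_pos two_pos (ha n)).le) (fun n => ?_) h
    have h4 : (1:ℝ) ≤ 4 * ((n : ℝ) + 1 - 1/2)^2 := by
      have : (0:ℝ) ≤ n := n.cast_nonneg
      nlinarith
    have hp : 0 < π^2 := by positivity
    rw [← mul_div_assoc, div_le_div_iff₀ (ha n) (by have := ha n; positivity)]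
    have : (1 + 4 / π^2) * (2*1) * (((n : ℝ) + 1 - 1/2)^2 * π^2)
      = 2 * (((n : ℝ) + 1 - 1/2)^2 * π^2) + 2 * (4 * ((n : ℝ) + 1 - 1/2)^2) := by
      field_simp
    rw [this]; linarith
  have hb : ∀ (n : ℕ) (y : ℝ), ‖2 * (((n : ℝ) + 1 - 1/2)^2 * π^2 - y^2) /
      (((n : ℝ) + 1 - 1/2)^2 * π^2 + y^2)^2‖ ≤ 2 / (((n : ℝ) + 1 - 1/2)^2 * π^2) := by
    intro n y
    have h := ha n
    generalize ((n : ℝ) + 1 - 1/2)^2 * π^2 = a at *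
    have h1 : |a - y^2| ≤ a + y^2 := abs_le.mpr ⟨by nlinarith [sq_nonneg y], by nlinarith [sq_nonneg y]⟩
    rw [Real.norm_eq_abs, abs_div, abs_mul, abs_two, abs_of_nonneg (sq_nonneg (a + y^2)),
      div_le_div_iff₀ (by positivity) h]
    have h2 : |a - y^2| * a ≤ (a + y^2) * (a + y^2) :=
      mul_le_mul h1 (by nlinarith [sq_nonneg y]) h.le (by positivity)
    nlinarith
  have hd : ∀ (n : ℕ) (y : ℝ), HasDerivAt
      (fun y : ℝ => 2 * y / (((n : ℝ) + 1 - 1/2)^2 * π^2 + y^2))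
      (2 * (((n : ℝ) + 1 - 1/2)^2 * π^2 - y^2) /
      (((n : ℝ) + 1 - 1/2)^2 * π^2 + y^2)^2) y := by
    intro n y
    have h := ha n
    generalize ((n : ℝ) + 1 - 1/2)^2 * π^2 = a at *
    have := ((hasDerivAt_id y).const_mul 2).div (((hasDerivAt_id y).pow 2).const_add a)
      (by
        have : 0 < a + y^2 := by positivity
        exact this.ne')
    convert! this using 1
    simp
    ring
  have hD := hasDerivAt_tsum hu hd hb (tanh_aux s hs.ne').summable s
  have hT : HasDerivAt Real.tanh ((1 / Real.cosh s)^2) s := by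
    have hch : Real.cosh s ≠ 0 := (Real.cosh_pos s).ne'
    have := (Real.hasDerivAt_sinh s).div (Real.hasDerivAt_cosh s) hch
    have e : Real.tanh = fun x => Real.sinh x / Real.cosh x := by
      funext x; exact Real.tanh_eq_sinh_div_cosh x
    rw [e]
    convert! this using 1
    have := Real.cosh_sq s
    field_simp
    linarith
  have hE := hD.congr_of_eventuallyEq (f₁ := Real.tanh) (by
    filter_upwards [lt_mem_nhds hs] with y hy
    exact (tanh_aux y hy.ne').tsum_eq.symm)
  rw [hT.unique hE]
  exact (Summable.of_norm_bounded hu (fun n => hb n s)).hasSum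

/-- For every `γ > 0`, the series `∑_{j=1}^∞ 2(j-1/2)²π²/((j-1/2)²π² + 2γ)²` converges and
equals `tanh(√(2γ))/(2√(2γ)) + (1/2)·sech(√(2γ))²`, where `sech = 1/cosh`. -/
theorem stmt_1 (γ : ℝ) (hγ : 0 < γ) :
    Summable (fun j : ℕ =>
      2 * (((j : ℝ) + 1) - 1/2)^2 * π^2 / ((((j : ℝ) + 1) - 1/2)^2 * π^2 + 2*γ)^2) ∧
    ∑' j : ℕ, 2 * (((j : ℝ) + 1) - 1/2)^2 * π^2 / ((((j : ℝ) + 1) - 1/2)^2 * π^2 + 2*γ)^2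
      = Real.tanh (Real.sqrt (2*γ)) / (2 * Real.sqrt (2*γ))
        + (1/2) * (1 / Real.cosh (Real.sqrt (2*γ)))^2 := by
  have hs : 0 < Real.sqrt (2*γ) := Real.sqrt_pos.mpr (by linarith)
  have hsq : 2*γ = Real.sqrt (2*γ)^2 := (Real.sq_sqrt (by linarith)).symm
  generalize Real.sqrt (2*γ) = s at *
  rw [hsq]
  have h := ((tanh_aux s hs.ne').div_const (2*s)).add ((sech_aux s hs).mul_left (1/2))
  have h' : HasSum (fun j : ℕ =>
      2 * (((j : ℝ) + 1) - 1/2)^2 * π^2 / ((((j : ℝ) + 1) - 1/2)^2 * π^2 + s^2)^2)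
      (Real.tanh s / (2*s) + (1/2) * (1 / Real.cosh s)^2) := by
    convert! h using 1
    funext n
    have hp : 0 < ((n : ℝ) + 1 - 1/2)^2 * π^2 + s^2 := by positivity
    rw [mul_assoc 2]
    generalize ((n : ℝ) + 1 - 1/2)^2 * π^2 = a at *
    field_simp
    ring
  exact ⟨h'.summable, h'.tsum_eq⟩
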